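/- Let λ₀ ≥ 0 and let A, B ∈ ℝ^{d×d} be symmetric positive semi-definite matrices with B ≠ 0. Then ‖Ψ_{λ₀}(A + B, clip) − Ψ_{λ₀}(A, clip)‖ ≤ ‖B‖ · (2/π + 1/2 + (1/π) · log((‖A − λ₀ I_d‖ + ‖B‖)/‖B‖)), where ‖·‖ is the operator norm. Moreover, ‖Ψ_{λ₀}(A + B, add) − Ψ_{λ₀}(A, add)‖ ≤ ‖B‖, where Ψ_{λ₀}(M, add) = M + λ₀ I_d. -/

import Mathlib

open Matrix

/-- The Euclidean norm on `ℝ^d`. -/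
noncomputable def enorm' {d : ℕ} (x : Fin d → ℝ) : ℝ := Real.sqrt (x ⬝ᵥ x)

/-- The `ℓ₂ → ℓ₂` operator norm of a matrix: `‖M‖ = sup_{‖x‖ ≤ 1} ‖Mx‖`. -/
noncomputable def opNorm' {d : ℕ} (M : Matrix (Fin d) (Fin d) ℝ) : ℝ :=
  sSup {r : ℝ | ∃ x : Fin d → ℝ, enorm' x ≤ 1 ∧ r = enorm' (M.mulVec x)}

/-- The eigenvalue clipping operator `Ψ_{λ₀}(A, clip) = Σ_i max{λ₀, λ_i} u_i u_iᵀ`,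
given by applying `t ↦ max{λ₀, t}` to `A` via the (continuous) functional calculus. -/
noncomputable def psiClip {d : ℕ} (lam0 : ℝ) (A : Matrix (Fin d) (Fin d) ℝ) :
    Matrix (Fin d) (Fin d) ℝ :=
  cfc (fun t : ℝ => max lam0 t) A

/-- The eigenvalue adding operator `Ψ_{λ₀}(A, add) = A + λ₀ I_d`. -/
noncomputable def psiAdd {d : ℕ} (lam0 : ℝ) (A : Matrix (Fin d) (Fin d) ℝ) :
    Matrix (Fin d) (Fin d) ℝ :=
  A + lam0 • (1 : Matrix (Fin d) (Fin d) ℝ)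

open scoped RealInnerProductSpace

theorem ContinuousLinearMap.norm_le_of_forall_abs_inner_le {E : Type*} [NormedAddCommGroup E]
    [InnerProductSpace ℝ E] {T : E →L[ℝ] E} (hT : T.IsSymmetric) {c : ℝ} (hc : 0 ≤ c)
    (h : ∀ u : E, ‖u‖ = 1 → |⟪T u, u⟫| ≤ c) : ‖T‖ ≤ c := by
  rw [T.norm_eq_iSup_rayleighQuotient hT]
  refine ciSup_le fun x => ?_
  rcases eq_or_ne x 0 with rfl | hx
  · simpa using hc
  · have hx' : ‖x‖ ≠ 0 := norm_ne_zero_iff.mpr hx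
    rw [← T.rayleigh_smul x (c := ‖x‖⁻¹) (inv_ne_zero hx')]
    have hn : ‖‖x‖⁻¹ • x‖ = 1 := by simp [norm_smul, hx']
    have := h _ hn
    simpa [ContinuousLinearMap.rayleighQuotient, hn, ContinuousLinearMap.reApplyInnerSelf_apply]
      using this

section Resolvent

variable {E : Type*} [NormedAddCommGroup E] [InnerProductSpace ℝ E] {S T : E →L[ℝ] E}
  {u y z : E} {t : ℝ}

/-- If `y = t² (S² + t²)⁻¹ u`, then `⟪u, y⟫ = ‖y‖² + ‖S y‖² / t²`. -/
theorem inner_resolvent (hS : S.IsSymmetric) (ht : 0 < t)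
    (hy : y + (t ^ 2)⁻¹ • S (S y) = u) : ⟪u, y⟫ = ‖y‖ ^ 2 + (‖S y‖ / t) ^ 2 := by
  have h : ⟪S (S y), y⟫ = ‖S y‖ ^ 2 := by
    rw [← real_inner_self_eq_norm_sq]; exact hS (S y) y
  rw [← hy, inner_add_left, real_inner_smul_left, h, real_inner_self_eq_norm_sq]
  field_simp

theorem sq_add_sq_le_norm_resolvent (hS : S.IsSymmetric) (ht : 0 < t) (hu : ‖u‖ = 1)
    (hy : y + (t ^ 2)⁻¹ • S (S y) = u) : ‖y‖ ^ 2 + (‖S y‖ / t) ^ 2 ≤ ‖y‖ := by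
  rw [← inner_resolvent hS ht hy]
  simpa [hu] using real_inner_le_norm u y

theorem norm_resolvent_le_one (hS : S.IsSymmetric) (ht : 0 < t) (hu : ‖u‖ = 1)
    (hy : y + (t ^ 2)⁻¹ • S (S y) = u) : ‖y‖ ≤ 1 := by
  nlinarith [sq_add_sq_le_norm_resolvent hS ht hu hy, norm_nonneg y, sq_nonneg (‖S y‖ / t)]

theorem abs_inner_resolvent_sub_le_one (hS : S.IsSymmetric) (hT : T.IsSymmetric) (ht : 0 < t)
    (hu : ‖u‖ = 1) (hy : y + (t ^ 2)⁻¹ • S (S y) = u) (hz : z + (t ^ 2)⁻¹ • T (T z) = u) :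
    |⟪u, z⟫ - ⟪u, y⟫| ≤ 1 := by
  rw [inner_resolvent hS ht hy, inner_resolvent hT ht hz, abs_le]
  have h1 := sq_add_sq_le_norm_resolvent hS ht hu hy
  have h2 := sq_add_sq_le_norm_resolvent hT ht hu hz
  have h3 := norm_resolvent_le_one hS ht hu hy
  have h4 := norm_resolvent_le_one hT ht hu hz
  constructor <;> linarith [sq_nonneg ‖y‖, sq_nonneg ‖z‖, sq_nonneg (‖S y‖ / t),
    sq_nonneg (‖T z‖ / t)]

theorem abs_inner_resolvent_sub_le (hT : T.IsSymmetric) (ht : 0 < t)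
    (hy : y + (t ^ 2)⁻¹ • S (S y) = u) (hz : z + (t ^ 2)⁻¹ • T (T z) = u) :
    |⟪u, z⟫ - ⟪u, y⟫| ≤ ‖S - T‖ / t ^ 2 * (‖z‖ * ‖S y‖ + ‖T z‖ * ‖y‖) := by
  have e1 : ⟪u, z⟫ = ⟪z, y⟫ + (t ^ 2)⁻¹ * ⟪z, S (S y)⟫ := by
    rw [← hy, real_inner_comm, inner_add_right, real_inner_smul_right]
  have e2 : ⟪u, y⟫ = ⟪z, y⟫ + (t ^ 2)⁻¹ * ⟪T z, T y⟫ := by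
    rw [← hz, inner_add_left, real_inner_smul_left]
    congr 2
    exact hT (T z) y
  have e3 : ⟪z, T (S y)⟫ = ⟪T z, S y⟫ := (hT z (S y)).symm
  have e4 : ⟪u, z⟫ - ⟪u, y⟫
      = (t ^ 2)⁻¹ * (⟪z, (S - T) (S y)⟫ + ⟪T z, (S - T) y⟫) := by
    rw [e1, e2, _root_.sub_apply, _root_.sub_apply, inner_sub_right,
      inner_sub_right, e3]
    ring
  have b1 : |⟪z, (S - T) (S y)⟫| ≤ ‖z‖ * (‖S - T‖ * ‖S y‖) :=
    (abs_real_inner_le_norm _ _).trans (by gcongr; exact (S - T).le_opNorm _)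
  have b2 : |⟪T z, (S - T) y⟫| ≤ ‖T z‖ * (‖S - T‖ * ‖y‖) :=
    (abs_real_inner_le_norm _ _).trans (by gcongr; exact (S - T).le_opNorm _)
  rw [e4, abs_mul, abs_of_pos (by positivity : 0 < (t ^ 2)⁻¹)]
  calc (t ^ 2)⁻¹ * |⟪z, (S - T) (S y)⟫ + ⟪T z, (S - T) y⟫|
      ≤ (t ^ 2)⁻¹ * (‖z‖ * (‖S - T‖ * ‖S y‖) + ‖T z‖ * (‖S - T‖ * ‖y‖)) := by
        gcongr
        exact (abs_add_le _ _).trans (add_le_add b1 b2)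
    _ = _ := by ring

theorem abs_inner_resolvent_sub_le_div (hS : S.IsSymmetric) (hT : T.IsSymmetric) (ht : 0 < t)
    (hu : ‖u‖ = 1) (hy : y + (t ^ 2)⁻¹ • S (S y) = u) (hz : z + (t ^ 2)⁻¹ • T (T z) = u) :
    |⟪u, z⟫ - ⟪u, y⟫| ≤ 2 / 3 * ‖S - T‖ / t := by
  have h1 := sq_add_sq_le_norm_resolvent hS ht hu hy
  have h2 := sq_add_sq_le_norm_resolvent hT ht hu hz
  have key : ‖z‖ * (‖S y‖ / t) + (‖T z‖ / t) * ‖y‖ ≤ 2 / 3 := by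
    nlinarith [sq_nonneg (2 * (‖S y‖ / t) - ‖z‖), sq_nonneg (2 * (‖T z‖ / t) - ‖y‖),
      sq_nonneg (‖y‖ - 2 / 3), sq_nonneg (‖z‖ - 2 / 3)]
  refine (abs_inner_resolvent_sub_le hT ht hy hz).trans ?_
  calc ‖S - T‖ / t ^ 2 * (‖z‖ * ‖S y‖ + ‖T z‖ * ‖y‖)
      = ‖S - T‖ / t * (‖z‖ * (‖S y‖ / t) + (‖T z‖ / t) * ‖y‖) := by field_simp
    _ ≤ ‖S - T‖ / t * (2 / 3) := by gcongr
    _ = _ := by ring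

theorem abs_inner_resolvent_sub_le_div_sq (hS : S.IsSymmetric) (hT : T.IsSymmetric) (ht : 0 < t)
    (hu : ‖u‖ = 1) (hy : y + (t ^ 2)⁻¹ • S (S y) = u) (hz : z + (t ^ 2)⁻¹ • T (T z) = u) :
    |⟪u, z⟫ - ⟪u, y⟫| ≤ ‖S - T‖ * (‖S‖ + ‖T‖) / t ^ 2 := by
  have h3 := norm_resolvent_le_one hS ht hu hy
  have h4 := norm_resolvent_le_one hT ht hu hz
  have hSy : ‖S y‖ ≤ ‖S‖ := by simpa using S.le_of_opNorm_le_of_le le_rfl h3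
  have hTz : ‖T z‖ ≤ ‖T‖ := by simpa using T.le_of_opNorm_le_of_le le_rfl h4
  refine (abs_inner_resolvent_sub_le hT ht hy hz).trans ?_
  calc ‖S - T‖ / t ^ 2 * (‖z‖ * ‖S y‖ + ‖T z‖ * ‖y‖)
      ≤ ‖S - T‖ / t ^ 2 * (1 * ‖S‖ + ‖T‖ * 1) := by gcongr
    _ = _ := by ring

end Resolvent

section Calculus

open Filter Topology Set

theorem abs_sub_le_sub_of_abs_deriv_le {f f' g g' : ℝ → ℝ} {a b : ℝ} (hab : a < b)
    (hfc : ContinuousOn f (Icc a b)) (hf : ∀ x ∈ Ioo a b, HasDerivAt f (f' x) x)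
    (hgc : ContinuousOn g (Icc a b)) (hg : ∀ x ∈ Ioo a b, HasDerivAt g (g' x) x)
    (hpos : ∀ x ∈ Ioo a b, 0 < g' x) (h : ∀ x ∈ Ioo a b, |f' x| ≤ g' x) :
    |f b - f a| ≤ g b - g a := by
  obtain ⟨c, hc, e⟩ := exists_ratio_hasDerivAt_eq_ratio_slope f f' hab hfc hf g g' hgc hg
  have hp := hpos c hc
  have h1 : f b - f a = (g b - g a) * (f' c / g' c) := by
    field_simp; linarith
  obtain ⟨ξ, hξ, e'⟩ := exists_hasDerivAt_eq_slope g g' hab hgc hg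
  have hg0 : 0 ≤ g b - g a := by
    have h2 := hpos ξ hξ
    rw [e', div_pos_iff_of_pos_right (sub_pos.2 hab)] at h2
    exact h2.le
  rw [h1, abs_mul, abs_of_nonneg hg0, abs_div, abs_of_pos hp]
  exact mul_le_of_le_one_right hg0 ((div_le_one hp).2 (h c hc))

theorem abs_limit_le_of_deriv_bounds {G g : ℝ → ℝ} {L β M : ℝ} (hβ : 0 < β) (hβM : β ≤ M)
    (hG0 : G 0 = 0) (hGc : Continuous G) (hG : ∀ t, 0 < t → HasDerivAt G (g t) t)
    (hL : Tendsto G atTop (𝓝 L)) (h1 : ∀ t, 0 < t → |g t| ≤ 1)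
    (h2 : ∀ t, 0 < t → |g t| ≤ 2 / 3 * β / t) (h3 : ∀ t, 0 < t → |g t| ≤ β * M / t ^ 2) :
    |L| ≤ 2 / 3 * β * (2 + Real.log (9 * M / (4 * β))) := by
  set c₁ := 2 / 3 * β with hc₁
  set c₂ := 3 / 2 * M with hc₂
  have hM : 0 < M := hβ.trans_le hβM
  have hc₁0 : 0 < c₁ := by positivity
  have hc₂0 : 0 < c₂ := by positivity
  have hc : c₁ < c₂ := by rw [hc₁, hc₂]; linarith
  have s1 : |G c₁ - G 0| ≤ c₁ - 0 :=
    abs_sub_le_sub_of_abs_deriv_le (g := fun t => t) (g' := fun _ => 1) hc₁0 hGc.continuousOn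
      (fun x hx => hG x hx.1) continuousOn_id (fun x _ => hasDerivAt_id x)
      (fun _ _ => one_pos) (fun x hx => h1 x hx.1)
  have s2 : |G c₂ - G c₁| ≤ c₁ * Real.log c₂ - c₁ * Real.log c₁ := by
    refine abs_sub_le_sub_of_abs_deriv_le (g := fun t => c₁ * Real.log t)
      (g' := fun t => c₁ * t⁻¹) hc hGc.continuousOn
      (fun x hx => hG x (hc₁0.trans hx.1)) ?_ ?_ ?_ ?_
    · exact continuousOn_const.mul (continuousOn_id.log fun x hx => (hc₁0.trans_le hx.1).ne')
    · exact fun x hx => (Real.hasDerivAt_log (hc₁0.trans hx.1).ne').const_mul c₁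
    · exact fun x hx => mul_pos hc₁0 (inv_pos.2 (hc₁0.trans hx.1))
    · exact fun x hx => h2 x (hc₁0.trans hx.1)
  have s3 : ∀ t, c₂ < t → |G t - G c₂| ≤ c₁ := by
    intro t ht
    have : |G t - G c₂| ≤ -(β * M) * t⁻¹ - -(β * M) * c₂⁻¹ := by
      refine abs_sub_le_sub_of_abs_deriv_le (g := fun t => -(β * M) * t⁻¹)
        (g' := fun t => -(β * M) * -(t ^ 2)⁻¹) ht hGc.continuousOn
        (fun x hx => hG x (hc₂0.trans hx.1)) ?_ ?_ ?_ ?_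
      · exact continuousOn_const.mul
          (continuousOn_id.inv₀ fun x hx => (hc₂0.trans_le hx.1).ne')
      · exact fun x hx => (hasDerivAt_inv (hc₂0.trans hx.1).ne').const_mul _
      · intro x hx
        have := hc₂0.trans hx.1
        rw [neg_mul_neg]
        positivity
      · intro x hx
        rw [neg_mul_neg]
        exact h3 x (hc₂0.trans hx.1)
    have e : β * M * c₂⁻¹ = c₁ := by rw [hc₁, hc₂]; field_simp
    have : 0 ≤ β * M * t⁻¹ := by have := hc₂0.trans ht; positivity
    linarith
  have e : Real.log (9 * M / (4 * β)) = Real.log c₂ - Real.log c₁ := by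
    rw [← Real.log_div hc₂0.ne' hc₁0.ne']
    congr 1
    rw [hc₁, hc₂]; field_simp; norm_num
  refine le_of_tendsto hL.abs ?_
  filter_upwards [eventually_gt_atTop c₂] with t ht
  have s := s3 t ht
  rw [e]
  rw [hG0] at s1
  rw [abs_le] at *
  constructor <;> linarith [s.1, s.2, s1.1, s1.2, s2.1, s2.2]

theorem hasDerivAt_mul_arctan_div (σ : ℝ) {t : ℝ} (ht : 0 < t) :
    HasDerivAt (fun t => σ * Real.arctan (t / σ)) (1 - t ^ 2 / (σ ^ 2 + t ^ 2)) t := by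
  rcases eq_or_ne σ 0 with rfl | hσ
  · simpa [ht.ne'] using hasDerivAt_const t (0 : ℝ)
  · have h := (((hasDerivAt_id' t).div_const σ).arctan).const_mul σ
    refine h.congr_deriv ?_
    have h1 : σ ^ 2 + t ^ 2 ≠ 0 := by positivity
    have h2 : 1 + (t / σ) ^ 2 ≠ 0 := by positivity
    rw [div_pow] at h2 ⊢
    field_simp
    ring

theorem tendsto_mul_arctan_div (σ : ℝ) :
    Tendsto (fun t => σ * Real.arctan (t / σ)) atTop (𝓝 (Real.pi / 2 * |σ|)) := by
  have key : ∀ τ : ℝ, 0 < τ →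
      Tendsto (fun t => τ * Real.arctan (t / τ)) atTop (𝓝 (Real.pi / 2 * τ)) := by
    intro τ hτ
    rw [mul_comm]
    exact ((tendsto_nhds_of_tendsto_nhdsWithin Real.tendsto_arctan_atTop).comp
      (tendsto_id.atTop_div_const hτ)).const_mul τ
  rcases lt_trichotomy σ 0 with h | rfl | h
  · rw [abs_of_neg h]
    refine (key (-σ) (neg_pos.2 h)).congr fun t => ?_
    rw [div_neg, Real.arctan_neg]; ring
  · simp
  · rw [abs_of_pos h]; exact key σ h

end Calculus

theorem log_resolvent_bound_le {r : ℝ} (hr : 1 ≤ r) :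
    2 / 3 * (2 + Real.log (9 * (2 * r - 1) / 4)) ≤ 2 + Real.log r := by
  have h0 : 0 < 9 * (2 * r - 1) / 4 := by linarith
  have hr0 : 0 < r := by linarith
  have he : (7 : ℝ) ≤ Real.exp 2 := by
    have h := Real.exp_one_gt_d9
    have : Real.exp 2 = Real.exp 1 ^ 2 := by rw [← Real.exp_nat_mul]; norm_num
    rw [this]; nlinarith
  have h : Real.log ((9 * (2 * r - 1) / 4) ^ 2) ≤ Real.log (Real.exp 2 * r ^ 3) := by
    apply Real.log_le_log (by positivity)
    have h7 : 7 * r ^ 3 ≤ Real.exp 2 * r ^ 3 := by gcongr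
    refine le_trans ?_ h7
    nlinarith [mul_nonneg (sub_nonneg.2 hr) (sq_nonneg (r - 1)), sq_nonneg (r - 1),
      mul_nonneg (sub_nonneg.2 hr) (sq_nonneg (2 * r - 3))]
  rw [Real.log_mul (Real.exp_pos 2).ne' (by positivity), Real.log_exp, Real.log_pow,
    Real.log_pow] at h
  push_cast at h
  linarith

section Matrices

open WithLp Filter Topology

variable {d : ℕ}

theorem enorm'_eq_norm_toLp (x : Fin d → ℝ) : enorm' x = ‖toLp 2 x‖ := by
  rw [enorm', norm_eq_sqrt_real_inner, EuclideanSpace.inner_toLp_toLp]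
  simp

theorem opNorm'_eq_norm_toEuclideanCLM (M : Matrix (Fin d) (Fin d) ℝ) :
    opNorm' M = ‖toEuclideanCLM (𝕜 := ℝ) M‖ := by
  rw [← ContinuousLinearMap.sSup_unitClosedBall_eq_norm, opNorm']
  congr 1
  ext r
  constructor
  · rintro ⟨x, hx, rfl⟩
    refine ⟨toLp 2 x, by simpa [← enorm'_eq_norm_toLp] using hx, ?_⟩
    simp [enorm'_eq_norm_toLp]
  · rintro ⟨x, hx, rfl⟩
    refine ⟨ofLp x, by simpa [enorm'_eq_norm_toLp] using hx, ?_⟩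
    simp [enorm'_eq_norm_toLp, ← toEuclideanCLM_toLp]

theorem Matrix.IsHermitian.isSymmetric_toEuclideanCLM {M : Matrix (Fin d) (Fin d) ℝ}
    (hM : M.IsHermitian) : (toEuclideanCLM (𝕜 := ℝ) M).IsSymmetric := by
  rw [coe_toEuclideanCLM_eq_toEuclideanLin]
  exact isSymmetric_toEuclideanLin_iff.2 hM

theorem Matrix.IsHermitian.exists_inner_cfc_eq_sum {M : Matrix (Fin d) (Fin d) ℝ}
    (hM : M.IsHermitian) (u : EuclideanSpace ℝ (Fin d)) :
    ∃ w : Fin d → ℝ, ∀ f : ℝ → ℝ,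
      ⟪u, toEuclideanCLM (𝕜 := ℝ) (cfc f M) u⟫ = ∑ i, w i * f (hM.eigenvalues i) := by
  set U : Matrix (Fin d) (Fin d) ℝ := hM.eigenvectorUnitary.1
  refine ⟨fun i => (star U *ᵥ u) i ^ 2, fun f => ?_⟩
  rw [inner_toEuclideanCLM, hM.cfc_eq, Matrix.IsHermitian.cfc, Unitary.conjStarAlgAut_apply,
    ← mulVec_mulVec, ← mulVec_mulVec, dotProduct_mulVec, ← mulVec_transpose, dotProduct]
  refine Finset.sum_congr rfl fun i _ => ?_
  rw [mulVec_diagonal]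
  simp [U, star_eq_conjTranspose]
  ring

theorem resolvent_cfc {M : Matrix (Fin d) (Fin d) ℝ} (hM : M.IsHermitian) {t : ℝ} (ht : 0 < t)
    (u : EuclideanSpace ℝ (Fin d)) :
    toEuclideanCLM (𝕜 := ℝ) (cfc (fun x => t ^ 2 / (x ^ 2 + t ^ 2)) M) u
      + (t ^ 2)⁻¹ • toEuclideanCLM (𝕜 := ℝ) M (toEuclideanCLM (𝕜 := ℝ) M
        (toEuclideanCLM (𝕜 := ℝ) (cfc (fun x => t ^ 2 / (x ^ 2 + t ^ 2)) M) u)) = u := by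
  have hsa : IsSelfAdjoint M := hM
  have hne : ∀ x : ℝ, x ^ 2 + t ^ 2 ≠ 0 := fun x => by positivity
  have hc : Continuous fun x : ℝ => t ^ 2 / (x ^ 2 + t ^ 2) := by fun_prop (disch := simp [hne])
  set Z := cfc (fun x => t ^ 2 / (x ^ 2 + t ^ 2)) M with hZ
  have h : Z + (t ^ 2)⁻¹ • (M * (M * Z)) = 1 := by
    have hc1 : Continuous fun x : ℝ => x * (t ^ 2 / (x ^ 2 + t ^ 2)) := by fun_prop
    have hc2 : Continuous fun x : ℝ => x * (x * (t ^ 2 / (x ^ 2 + t ^ 2))) := by fun_prop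
    have h1 : M * Z = cfc (fun x => x * (t ^ 2 / (x ^ 2 + t ^ 2))) M := by
      rw [cfc_mul (fun x => x) _ M (by fun_prop) hc.continuousOn, cfc_id' ℝ M]
    have h2 : M * (M * Z) = cfc (fun x => x * (x * (t ^ 2 / (x ^ 2 + t ^ 2)))) M := by
      rw [cfc_mul (fun x => x) _ M (by fun_prop) hc1.continuousOn, cfc_id' ℝ M, h1]
    rw [h2, ← cfc_smul _ _ M hc2.continuousOn, hZ, ← cfc_add M _ _ hc.continuousOn
      (by fun_prop), ← cfc_const_one ℝ M]
    congr 1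
    ext x
    have := hne x
    simp only [smul_eq_mul]
    field_simp
    ring
  have h' := congrArg (fun N => toEuclideanCLM (𝕜 := ℝ) N u) h
  rw [map_add, map_smul, map_mul, map_mul, map_one] at h'
  exact h'

theorem abs_inner_cfc_abs_sub_le {S T : Matrix (Fin d) (Fin d) ℝ} (hS : S.IsHermitian)
    (hT : T.IsHermitian) {β M : ℝ} (hβ : ‖toEuclideanCLM (𝕜 := ℝ) (S - T)‖ = β) (hβ0 : 0 < β)
    (hM : ‖toEuclideanCLM (𝕜 := ℝ) S‖ + ‖toEuclideanCLM (𝕜 := ℝ) T‖ ≤ M) (hβM : β ≤ M)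
    {u : EuclideanSpace ℝ (Fin d)} (hu : ‖u‖ = 1) :
    Real.pi / 2 * |⟪u, toEuclideanCLM (𝕜 := ℝ) (cfc (fun x : ℝ => |x|) S) u⟫
        - ⟪u, toEuclideanCLM (𝕜 := ℝ) (cfc (fun x : ℝ => |x|) T) u⟫|
      ≤ 2 / 3 * β * (2 + Real.log (9 * M / (4 * β))) := by
  obtain ⟨w, hw⟩ := hS.exists_inner_cfc_eq_sum u
  obtain ⟨v, hv⟩ := hT.exists_inner_cfc_eq_sum u
  have hSsa : IsSelfAdjoint S := hS
  have hTsa : IsSelfAdjoint T := hT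
  have hw1 : ∑ i, w i = 1 := by
    have := hw (fun _ => 1)
    rw [cfc_const_one ℝ S] at this
    simpa [hu] using this.symm
  have hv1 : ∑ i, v i = 1 := by
    have := hv (fun _ => 1)
    rw [cfc_const_one ℝ T] at this
    simpa [hu] using this.symm
  rw [← abs_of_pos (half_pos Real.pi_pos), ← abs_mul, hw, hv]
  have hd : ∀ t : ℝ, ∑ i, w i * (1 - t ^ 2 / (hS.eigenvalues i ^ 2 + t ^ 2))
        - ∑ i, v i * (1 - t ^ 2 / (hT.eigenvalues i ^ 2 + t ^ 2))
      = ⟪u, toEuclideanCLM (𝕜 := ℝ) (cfc (fun x => t ^ 2 / (x ^ 2 + t ^ 2)) T) u⟫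
        - ⟪u, toEuclideanCLM (𝕜 := ℝ) (cfc (fun x => t ^ 2 / (x ^ 2 + t ^ 2)) S) u⟫ := by
    intro t
    rw [hw, hv]
    simp only [mul_sub, mul_one, Finset.sum_sub_distrib, hw1, hv1]
    ring
  have hS' := hS.isSymmetric_toEuclideanCLM
  have hT' := hT.isSymmetric_toEuclideanCLM
  have hsub : ‖toEuclideanCLM (𝕜 := ℝ) S - toEuclideanCLM (𝕜 := ℝ) T‖ = β := by
    rw [← map_sub, hβ]
  refine abs_limit_le_of_deriv_bounds
    (G := fun t => ∑ i, w i * (hS.eigenvalues i * Real.arctan (t / hS.eigenvalues i))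
      - ∑ i, v i * (hT.eigenvalues i * Real.arctan (t / hT.eigenvalues i)))
    (g := fun t => ∑ i, w i * (1 - t ^ 2 / (hS.eigenvalues i ^ 2 + t ^ 2))
        - ∑ i, v i * (1 - t ^ 2 / (hT.eigenvalues i ^ 2 + t ^ 2)))
    hβ0 hβM (by simp) ?_ ?_ ?_ ?_ ?_ ?_
  · have h : ∀ σ : ℝ, Continuous fun t : ℝ => σ * Real.arctan (t / σ) := fun σ =>
      continuous_const.mul (Real.continuous_arctan.comp (continuous_id.div_const σ))
    exact (continuous_finsetSum _ fun i _ => continuous_const.mul (h _)).sub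
      (continuous_finsetSum _ fun i _ => continuous_const.mul (h _))
  · intro t ht
    exact (HasDerivAt.fun_sum fun i _ => (hasDerivAt_mul_arctan_div _ ht).const_mul (w i)).sub
      (HasDerivAt.fun_sum fun i _ => (hasDerivAt_mul_arctan_div _ ht).const_mul (v i))
  · rw [mul_sub, Finset.mul_sum, Finset.mul_sum]
    simp only [mul_left_comm (Real.pi / 2)]
    exact (tendsto_finsetSum _ fun i _ => (tendsto_mul_arctan_div _).const_mul (w i)).sub
      (tendsto_finsetSum _ fun i _ => (tendsto_mul_arctan_div _).const_mul (v i))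
  · intro t ht
    rw [hd]
    exact abs_inner_resolvent_sub_le_one hS' hT' ht hu (resolvent_cfc hS ht u)
      (resolvent_cfc hT ht u)
  · intro t ht
    rw [hd, ← hsub]
    exact abs_inner_resolvent_sub_le_div hS' hT' ht hu (resolvent_cfc hS ht u)
      (resolvent_cfc hT ht u)
  · intro t ht
    rw [hd]
    refine (abs_inner_resolvent_sub_le_div_sq hS' hT' ht hu (resolvent_cfc hS ht u)
      (resolvent_cfc hT ht u)).trans ?_
    rw [hsub]
    gcongr

theorem psiClip_eq_half_smul {A : Matrix (Fin d) (Fin d) ℝ} (hA : A.IsHermitian) (lam0 : ℝ) :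
    psiClip lam0 A = (1 / 2 : ℝ) • (A + lam0 • (1 : Matrix (Fin d) (Fin d) ℝ)
      + cfc (fun x : ℝ => |x|) (A - lam0 • (1 : Matrix (Fin d) (Fin d) ℝ))) := by
  have hsa : IsSelfAdjoint A := hA
  have h1 : A + lam0 • (1 : Matrix (Fin d) (Fin d) ℝ) = cfc (fun x => x + lam0) A := by
    rw [cfc_add_const lam0 (fun x => x) A, cfc_id' ℝ A, Algebra.algebraMap_eq_smul_one]
  have h2 : A - lam0 • (1 : Matrix (Fin d) (Fin d) ℝ) = cfc (fun x => x - lam0) A := by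
    rw [cfc_sub (fun x => x) (fun _ => lam0) A, cfc_id' ℝ A, cfc_const lam0 A,
      Algebra.algebraMap_eq_smul_one]
  rw [h2, ← cfc_comp' (fun x : ℝ => |x|) (fun x => x - lam0) A, h1, ← cfc_add .., ← cfc_smul ..,
    psiClip]
  congr 1
  ext x
  rcases le_total x lam0 with h | h
  · rw [max_eq_left h, abs_of_nonpos (sub_nonpos.2 h), smul_eq_mul]; ring
  · rw [max_eq_right h, abs_of_nonneg (sub_nonneg.2 h), smul_eq_mul]; ring

theorem psiClip_sub_form {A B : Matrix (Fin d) (Fin d) ℝ} (hA : A.IsHermitian)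
    (hB : B.IsHermitian) (lam0 : ℝ) :
    psiClip lam0 (A + B) - psiClip lam0 A = (1 / 2 : ℝ) • (B
      + (cfc (fun x : ℝ => |x|) (A + B - lam0 • (1 : Matrix (Fin d) (Fin d) ℝ))
        - cfc (fun x : ℝ => |x|) (A - lam0 • (1 : Matrix (Fin d) (Fin d) ℝ)))) := by
  rw [psiClip_eq_half_smul hA, psiClip_eq_half_smul (hA.add hB), ← smul_sub]
  congr 1
  abel

end Matrices

/-- Let `λ₀ ≥ 0` and `A, B` symmetric PSD with `B ≠ 0`. Then
`‖Ψ_{λ₀}(A+B, clip) − Ψ_{λ₀}(A, clip)‖ ≤ ‖B‖(2/π + 1/2 + (1/π) log((‖A − λ₀I‖ + ‖B‖)/‖B‖))`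
and `‖Ψ_{λ₀}(A+B, add) − Ψ_{λ₀}(A, add)‖ ≤ ‖B‖` (operator norms). -/
theorem psiClip_psiAdd_operator_lipschitz {d : ℕ} (lam0 : ℝ) (hlam0 : 0 ≤ lam0)
    (A B : Matrix (Fin d) (Fin d) ℝ) (hA : A.PosSemidef) (hB : B.PosSemidef)
    (hBne : B ≠ 0) :
    opNorm' (psiClip lam0 (A + B) - psiClip lam0 A)
        ≤ opNorm' B * (2 / Real.pi + 1 / 2
            + (1 / Real.pi) * Real.log
                ((opNorm' (A - lam0 • (1 : Matrix (Fin d) (Fin d) ℝ)) + opNorm' B)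
                  / opNorm' B)) ∧
      opNorm' (psiAdd lam0 (A + B) - psiAdd lam0 A) ≤ opNorm' B := by
  have hAh := hA.isHermitian
  have hBh := hB.isHermitian
  refine ⟨?_, by simp [psiAdd]⟩
  simp only [opNorm'_eq_norm_toEuclideanCLM]
  set X := A - lam0 • (1 : Matrix (Fin d) (Fin d) ℝ) with hX
  set a := ‖toEuclideanCLM (𝕜 := ℝ) X‖ with ha
  set b := ‖toEuclideanCLM (𝕜 := ℝ) B‖ with hb
  have ha0 : 0 ≤ a := norm_nonneg _
  have hb0 : 0 < b := norm_pos_iff.2 ((map_ne_zero_iff _ (toEuclideanCLM).injective).2 hBne)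
  have hXh : X.IsHermitian := hAh.sub (by simp [Matrix.IsHermitian])
  have hYX : A + B - lam0 • (1 : Matrix (Fin d) (Fin d) ℝ) = X + B := by rw [hX]; abel
  have hYh : (X + B).IsHermitian := hXh.add hBh
  have hYn : ‖toEuclideanCLM (𝕜 := ℝ) (X + B)‖ ≤ a + b := by
    rw [map_add]; exact norm_add_le _ _
  have hr : 1 ≤ (a + b) / b := by rw [one_le_div hb0]; linarith
  have hlog := log_resolvent_bound_le hr
  have hlog0 := Real.log_nonneg hr
  have harg : 9 * (2 * ((a + b) / b) - 1) / 4 = 9 * (2 * a + b) / (4 * b) := by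
    field_simp; ring
  rw [harg] at hlog
  have hpi := Real.pi_pos
  refine ContinuousLinearMap.norm_le_of_forall_abs_inner_le ?_ (by positivity) fun u hu => ?_
  · refine Matrix.IsHermitian.isSymmetric_toEuclideanCLM ?_
    exact (cfc_predicate _ _ : IsSelfAdjoint (psiClip lam0 (A + B))).sub
      (cfc_predicate _ _ : IsSelfAdjoint (psiClip lam0 A))
  · have hk := abs_inner_cfc_abs_sub_le (β := b) (M := 2 * a + b) hYh hXh (by simp [hb]) hb0
      (by linarith) (by linarith) hu
    have hBu : |⟪u, toEuclideanCLM (𝕜 := ℝ) B u⟫| ≤ b := by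
      refine (abs_real_inner_le_norm _ _).trans ?_
      simpa [hu] using (toEuclideanCLM (𝕜 := ℝ) B).le_opNorm u
    rw [psiClip_sub_form hAh hBh, hYX, real_inner_comm]
    simp only [map_smul, map_add, map_sub, _root_.smul_apply,
      _root_.add_apply, _root_.sub_apply, real_inner_smul_right,
      inner_add_right, inner_sub_right]
    set p := ⟪u, toEuclideanCLM (𝕜 := ℝ) B u⟫
    set q := ⟪u, toEuclideanCLM (𝕜 := ℝ) (cfc (fun x : ℝ => |x|) (X + B)) u⟫
      - ⟪u, toEuclideanCLM (𝕜 := ℝ) (cfc (fun x : ℝ => |x|) X) u⟫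
    have hq : |q| / 2 ≤ b * (2 + Real.log ((a + b) / b)) / Real.pi := by
      rw [le_div_iff₀ hpi]
      nlinarith [mul_le_mul_of_nonneg_left hlog hb0.le]
    rw [abs_mul, abs_of_pos (by norm_num : (0 : ℝ) < 1 / 2)]
    calc 1 / 2 * |p + q| ≤ b / 2 + |q| / 2 := by linarith [abs_add_le p q]
      _ ≤ b / 2 + b * (2 + Real.log ((a + b) / b)) / Real.pi := by gcongr
      _ = _ := by ring
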